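/- Let A = kQ/I be a locally gentle algebra. Then A satisfies (CM2) if and only if A has no finite maximal paths; in that case, A is a finitely generated free module over the polynomial subalgebra k[x], where x = Σ_{α∈Q1} α is the sum of all arrows of Q. -/

import Mathlib

/- Common framework for (locally) gentle algebras -/

noncomputable section
open scoped BigOperators
open CategoryTheory

namespace LocGentle

/-- A finite connected quiver with at least one vertex and one arrow. -/
structure Quiv where
  V : Type
  Arr : Type
  [fintypeV : Fintype V]
  [fintypeA : Fintype Arr]
  [decEqV : DecidableEq V]
  [decEqA : DecidableEq Arr]
  src : Arr → V
  tgt : Arr → V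
  [nonemptyV : Nonempty V]
  [nonemptyA : Nonempty Arr]
  connected : (SimpleGraph.fromRel (fun v w => ∃ a, src a = v ∧ tgt a = w)).Connected

attribute [instance] Quiv.fintypeV Quiv.fintypeA Quiv.decEqV Quiv.decEqA
  Quiv.nonemptyV Quiv.nonemptyA

variable (Q : Quiv)

/-- in-degree of a vertex -/
def indeg (v : Q.V) : ℕ := (Finset.univ.filter (fun a => Q.tgt a = v)).card

/-- out-degree of a vertex -/
def outdeg (v : Q.V) : ℕ := (Finset.univ.filter (fun a => Q.src a = v)).card

/-- a list of arrows is composable (forms a path) -/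
def Composable (l : List Q.Arr) : Prop := l.Chain' (fun a b => Q.tgt a = Q.src b)

variable {Q}

/-- source vertex of a nonempty word -/
def wSrc? (l : List Q.Arr) : Option Q.V := l.head?.map Q.src

/-- target vertex of a nonempty word -/
def wTgt? (l : List Q.Arr) : Option Q.V := l.getLast?.map Q.tgt

/-- target of a word, with a default value (used for stationary paths) -/
def wTgtD (l : List Q.Arr) (v : Q.V) : Q.V := (l.getLast?.map Q.tgt).getD v

/-- last arrow of a word, with a (junk) default -/
def wLast (l : List Q.Arr) : Q.Arr := l.getLast?.getD (Classical.arbitrary _)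

variable (rel : Q.Arr → Q.Arr → Prop)

/-- A word is allowed (is a basis path of `A = kQ/I`) if consecutive arrows are
composable and no consecutive pair lies in the relation set generating `I`. -/
def AllowedWord (l : List Q.Arr) : Prop :=
  l.Chain' (fun a b => Q.tgt a = Q.src b ∧ ¬ rel a b)

/-- right maximal paths (of positive length) -/
def RightMaxWord (l : List Q.Arr) : Prop :=
  l ≠ [] ∧ AllowedWord rel l ∧ ∀ a : Q.Arr, ¬ AllowedWord rel (l ++ [a])

/-- left maximal paths (of positive length) -/
def LeftMaxWord (l : List Q.Arr) : Prop :=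
  l ≠ [] ∧ AllowedWord rel l ∧ ∀ a : Q.Arr, ¬ AllowedWord rel (a :: l)

/-- finite maximal paths -/
def FiniteMaxWord (l : List Q.Arr) : Prop := RightMaxWord rel l ∧ LeftMaxWord rel l

/-- a word is primitive if it is not a proper power -/
def PrimitiveWord (l : List Q.Arr) : Prop :=
  ∀ (l' : List Q.Arr) (n : ℕ), 2 ≤ n → l ≠ (List.replicate n l').flatten

/-- a primitive cycle `c` with `c² ∉ I`; these represent the infinite maximal paths `c^∞`. -/
def PrimCycleSq (c : List Q.Arr) : Prop :=
  c ≠ [] ∧ AllowedWord rel (c ++ c) ∧ wTgt? c = wSrc? c ∧ PrimitiveWord c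

/-- the maximal path `γ_α` containing `α` is infinite -/
def InfThrough (a : Q.Arr) : Prop := ∃ c, PrimCycleSq rel c ∧ a ∈ c

/-- the maximal path `γ_α` containing `α` is finite -/
def FinThrough (a : Q.Arr) : Prop := ∃ l, FiniteMaxWord rel l ∧ a ∈ l

/-- the rotation of the cycle `c` starting at the arrow `a`; when `a ∈ c` and `c` has no
duplicates this is the primitive cycle `γ_r(a)`. -/
def rotTo (c : List Q.Arr) (a : Q.Arr) : List Q.Arr :=
  c.dropWhile (fun b => b != a) ++ c.takeWhile (fun b => b != a)

/-- the relation set of the Koszul dual `A#`; its allowed words are the forbidden paths of `A`. -/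
def dualRel : Q.Arr → Q.Arr → Prop := fun a b => Q.tgt a = Q.src b ∧ ¬ rel a b

/-- a forbidden path of `A`, i.e. a path of the Koszul dual `A#` -/
def ForbiddenWord (l : List Q.Arr) : Prop := AllowedWord (dualRel rel) l

variable (Q)

/-- The defining conditions (i)-(iv) of a (locally) gentle algebra, in terms of the set of
length-two relations generating the ideal `I`: an algebra satisfying them is gentle if it
is finite dimensional and locally gentle otherwise. -/
structure IsGentleRel : Prop where
  indeg_le : ∀ v : Q.V, indeg Q v ≤ 2
  outdeg_le : ∀ v : Q.V, outdeg Q v ≤ 2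
  rel_comp : ∀ a b : Q.Arr, rel a b → Q.tgt a = Q.src b
  cond_ii : ∀ a b b' : Q.Arr, b ≠ b' → Q.tgt b = Q.src a → Q.tgt b' = Q.src a →
    Xor' (rel b a) (rel b' a)
  cond_iii : ∀ a b b' : Q.Arr, b ≠ b' → Q.tgt a = Q.src b → Q.tgt a = Q.src b' →
    Xor' (rel a b) (rel a b')

/-- `Q` is (as a quiver) the extended Dynkin quiver `Ã_n` (for `n = |Q₀| - 1`):
every vertex has in-degree and out-degree one. -/
def IsAtilde : Prop := ∀ v : Q.V, indeg Q v = 1 ∧ outdeg Q v = 1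

/-- paths of `Q`, including the stationary paths (`w = []`) at each vertex -/
structure Pth where
  s : Q.V
  w : List Q.Arr
  hs : ∀ a ∈ w.head?, Q.src a = s
  hc : Composable Q w

variable {Q}

/-- target of a path -/
def Pth.t (p : Pth Q) : Q.V := wTgtD p.w p.s

/-- length of a path -/
def Pth.len (p : Pth Q) : ℕ := p.w.length

/-- a basis path of `A = kQ/I` -/
def Pth.Allowed (p : Pth Q) : Prop := AllowedWord rel p.w

end LocGentle
namespace LocGentle

variable (k : Type) [Field k] (Q : Quiv) (rel : Q.Arr → Q.Arr → Prop)

/-- The defining relations presenting `A = kQ/I` as a quotient of the free algebra on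
the stationary paths (vertices) and arrows: the path algebra relations together with
the relations `αβ = 0` for the length-two paths `αβ` generating `I`. -/
inductive GARel : FreeAlgebra k (Q.V ⊕ Q.Arr) → FreeAlgebra k (Q.V ⊕ Q.Arr) → Prop
  | idem (v : Q.V) : GARel (FreeAlgebra.ι k (Sum.inl v) * FreeAlgebra.ι k (Sum.inl v))
      (FreeAlgebra.ι k (Sum.inl v))
  | orth (v w : Q.V) : v ≠ w → GARel (FreeAlgebra.ι k (Sum.inl v) * FreeAlgebra.ι k (Sum.inl w)) 0
  | unit : GARel (∑ v : Q.V, FreeAlgebra.ι k (Sum.inl v)) 1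
  | src_mul (a : Q.Arr) : GARel (FreeAlgebra.ι k (Sum.inl (Q.src a)) * FreeAlgebra.ι k (Sum.inr a))
      (FreeAlgebra.ι k (Sum.inr a))
  | mul_tgt (a : Q.Arr) : GARel (FreeAlgebra.ι k (Sum.inr a) * FreeAlgebra.ι k (Sum.inl (Q.tgt a)))
      (FreeAlgebra.ι k (Sum.inr a))
  | src_zero (v : Q.V) (a : Q.Arr) : v ≠ Q.src a →
      GARel (FreeAlgebra.ι k (Sum.inl v) * FreeAlgebra.ι k (Sum.inr a)) 0
  | tgt_zero (v : Q.V) (a : Q.Arr) : v ≠ Q.tgt a →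
      GARel (FreeAlgebra.ι k (Sum.inr a) * FreeAlgebra.ι k (Sum.inl v)) 0
  | rel_zero (a b : Q.Arr) : rel a b →
      GARel (FreeAlgebra.ι k (Sum.inr a) * FreeAlgebra.ι k (Sum.inr b)) 0

/-- The (locally) gentle algebra `A = kQ/I`. -/
abbrev GA := RingQuot (GARel k Q rel)

/-- the image in `A` of the stationary path at `v` -/
def vtx (v : Q.V) : GA k Q rel := RingQuot.mkAlgHom k _ (FreeAlgebra.ι k (Sum.inl v))

/-- the image in `A` of the arrow `a` -/
def arr (a : Q.Arr) : GA k Q rel := RingQuot.mkAlgHom k _ (FreeAlgebra.ι k (Sum.inr a))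

/-- the image in `A` of the word `l` (the product of its arrows) -/
def wordEl (l : List Q.Arr) : GA k Q rel := (l.map (arr k Q rel)).prod

variable {Q}

/-- the image in `A` of a path (a stationary path maps to the corresponding idempotent) -/
def Pth.el (p : Pth Q) : GA k Q rel := vtx k Q rel p.s * wordEl k Q rel p.w

variable (Q)

/-- the `n`-th graded component `A_n` of `A`, spanned by the images of paths of length `n` -/
def deg (n : ℕ) : Submodule k (GA k Q rel) :=
  Submodule.span k {x | ∃ p : Pth Q, p.Allowed rel ∧ p.len = n ∧ x = p.el k rel}

/-- the augmentation ideal `A₊` (as a `k`-submodule), spanned by paths of positive length -/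
def degPlus : Submodule k (GA k Q rel) :=
  Submodule.span k {x | ∃ p : Pth Q, p.Allowed rel ∧ 1 ≤ p.len ∧ x = p.el k rel}

/-- the Hilbert series of `A` (with integer coefficients) -/
def hilb : PowerSeries ℤ :=
  PowerSeries.mk fun n => (Module.finrank k (deg k Q rel n) : ℤ)

/-- the Hilbert series of `A` (with rational coefficients) -/
def hilbQ : PowerSeries ℚ :=
  PowerSeries.mk fun n => (Module.finrank k (deg k Q rel n) : ℚ)

/-- the number `k_n` of finite maximal paths of length at least `n` -/
def numFMP (n : ℕ) : ℕ := {l : List Q.Arr | FiniteMaxWord rel l ∧ n ≤ l.length}.ncard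

/-- the Gelfand-Kirillov dimension of `A`:
`limsup_n log (dim_k A_{≤ n}) / log n`. -/
def GKdim : ℝ :=
  Filter.limsup (fun n : ℕ =>
      Real.log (Module.finrank k ↥(⨆ i ∈ Finset.range (n + 1), deg k Q rel i)) / Real.log n)
    Filter.atTop

/-- the central element `m_γ` attached to the infinite maximal path `γ = c^∞`:
the sum over the arrows `α` of `c` of the primitive cycle `γ_r(α)` starting at `α`. -/
def mEl (c : List Q.Arr) : GA k Q rel := (c.map fun a => wordEl k Q rel (rotTo c a)).sum

/-- evaluation of a polynomial at `x ∈ A`; `polyEval k Q rel p x` is `p(x)`. -/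
def polyEval (p : Polynomial k) (x : GA k Q rel) : GA k Q rel :=
  Polynomial.eval₂ (algebraMap k (GA k Q rel)) x p

end LocGentle
namespace LocGentle

variable (k : Type) [Field k] (Q : Quiv) (rel : Q.Arr → Q.Arr → Prop)

/-! ### Two-sided ideals and primes -/

/-- a prime (two-sided) ideal -/
def IsPrimeTI (P : TwoSidedIdeal (GA k Q rel)) : Prop :=
  P ≠ ⊤ ∧ ∀ x y : GA k Q rel, (∀ a : GA k Q rel, x * a * y ∈ P) → x ∈ P ∨ y ∈ P

/-- the maximal ideal `𝔪_v` of `A` which does not contain `ε_v`: it is generated by the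
stationary paths at the other vertices together with all loops at `v`. -/
def mIdeal (v : Q.V) : TwoSidedIdeal (GA k Q rel) :=
  TwoSidedIdeal.span
    ({x | ∃ w : Q.V, w ≠ v ∧ x = vtx k Q rel w} ∪
     {x | ∃ a : Q.Arr, Q.src a = v ∧ Q.tgt a = v ∧ x = arr k Q rel a})

/-- the ideal `J_γ` corresponding to the infinite maximal path `γ = c^∞`, generated by
all arrows lying on `γ` -/
def Jgamma (c : List Q.Arr) : TwoSidedIdeal (GA k Q rel) :=
  TwoSidedIdeal.span {x | ∃ a ∈ c, x = arr k Q rel a}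

/-- the left annihilator of `J_γ` -/
def annJ (c : List Q.Arr) : Set (GA k Q rel) :=
  {x | ∀ y ∈ Jgamma k Q rel c, x * y = 0}

/-! ### The simple modules `S(v)`, and `Ext` groups -/

/-- the algebra map `A → k` corresponding to the vertex `v` (projection onto the
coefficient of `ε_v`) -/
def vtxHomAux (v : Q.V) : FreeAlgebra k (Q.V ⊕ Q.Arr) →ₐ[k] k :=
  FreeAlgebra.lift k (Sum.elim (fun w => if w = v then (1 : k) else 0) (fun _ => 0))

theorem vtxHomAux_rel (v : Q.V) : ∀ ⦃x y⦄, GARel k Q rel x y →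
    vtxHomAux k Q v x = vtxHomAux k Q v y := by
  intro x y h
  cases h with
  | idem w =>
      simp only [vtxHomAux, map_mul, FreeAlgebra.lift_ι_apply, Sum.elim_inl]
      split_ifs <;> simp
  | orth w w' hne =>
      simp only [vtxHomAux, map_mul, FreeAlgebra.lift_ι_apply, Sum.elim_inl, map_zero]
      split_ifs with h1 h2 <;> first | (exact absurd (h1.trans h2.symm) hne) | simp
  | unit =>
      simp only [vtxHomAux, map_sum, FreeAlgebra.lift_ι_apply, Sum.elim_inl, map_one]
      simp [Finset.sum_ite_eq' Finset.univ v (fun _ => (1:k))]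
  | src_mul a =>
      simp [vtxHomAux, map_mul, FreeAlgebra.lift_ι_apply]
  | mul_tgt a =>
      simp [vtxHomAux, map_mul, FreeAlgebra.lift_ι_apply]
  | src_zero w a hw =>
      simp [vtxHomAux, map_mul, FreeAlgebra.lift_ι_apply]
  | tgt_zero w a hw =>
      simp [vtxHomAux, map_mul, FreeAlgebra.lift_ι_apply]
  | rel_zero a b hab =>
      simp [vtxHomAux, map_mul, FreeAlgebra.lift_ι_apply]

/-- the ring map `A → k` corresponding to the vertex `v` -/
def vtxHom (v : Q.V) : GA k Q rel →+* k :=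
  RingQuot.lift ⟨(vtxHomAux k Q v).toRingHom, fun _ _ h => vtxHomAux_rel k Q rel v h⟩

/-- the ring map `A → k^{Q₀}` with kernel `A₊` -/
def SHom : GA k Q rel →+* (Q.V → k) := Pi.ringHom fun v => vtxHom k Q rel v

/-- the graded simple right `A`-module `S(v)` at the vertex `v` -/
def SvModR (v : Q.V) : ModuleCat (GA k Q rel)ᵐᵒᵖ :=
  @ModuleCat.of _ _ k _
    (Module.compHom k ((vtxHom k Q rel v).fromOpposite (fun _ _ => mul_comm _ _)))

/-- the graded simple left `A`-module `S(v)` at the vertex `v` -/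
def SvModL (v : Q.V) : ModuleCat (GA k Q rel) :=
  @ModuleCat.of _ _ k _ (Module.compHom k (vtxHom k Q rel v))

/-- `S = A/A₊ ≅ ⊕_v S(v)` as a right `A`-module -/
def SModR : ModuleCat (GA k Q rel)ᵐᵒᵖ :=
  @ModuleCat.of _ _ (Q.V → k) _
    (Module.compHom _ ((SHom k Q rel).fromOpposite (fun _ _ => mul_comm _ _)))

/-- `S = A/A₊` as a left `A`-module -/
def SModL : ModuleCat (GA k Q rel) :=
  @ModuleCat.of _ _ (Q.V → k) _ (Module.compHom _ (SHom k Q rel))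

/-- `A` as a right module over itself -/
def AModR : ModuleCat (GA k Q rel)ᵐᵒᵖ := ModuleCat.of _ (GA k Q rel)

/-- `A` as a left module over itself -/
def AModL : ModuleCat (GA k Q rel) := ModuleCat.of _ (GA k Q rel)

/-- nonvanishing of `Ext^i(M, N)` for modules over a ring `R` -/
def extNZ {R : Type} [Ring R] (i : ℕ) (M N : ModuleCat R) : Prop :=
  ¬ Subsingleton (((Ext ℤ (ModuleCat R) i).obj (Opposite.op M)).obj N)

/-- nonvanishing of `Ext^i_A(S(v), A)` in right `A`-modules.  (For the Noetherian graded
algebra `A` with the finitely generated modules `S(v)` and `A` this agrees with the graded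
`Ext`-group, summed over all shifts, used in the paper.) -/
def extSvNZ (i : ℕ) (v : Q.V) : Prop := extNZ i (SvModR k Q rel v) (AModR k Q rel)

/-- nonvanishing of `Ext^i_A(S, A)` in right `A`-modules -/
def extSNZ (i : ℕ) : Prop := extNZ i (SModR k Q rel) (AModR k Q rel)

/-- the depth of `A`: `min { i : Ext^i_A(S, A) ≠ 0 }` -/
def depth : ℕ∞ := sInf {n : ℕ∞ | ∃ i : ℕ, n = i ∧ extSNZ k Q rel i}

/-- the right self-injective dimension of `A`:
`sup { i : Ext^i(M, A) ≠ 0 for some right module M }` -/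
def rInjDim : ℕ∞ :=
  sSup {n : ℕ∞ | ∃ (i : ℕ) (M : ModuleCat.{0} (GA k Q rel)ᵐᵒᵖ), n = i ∧ extNZ i M (AModR k Q rel)}

/-- the left self-injective dimension of `A` -/
def lInjDim : ℕ∞ :=
  sSup {n : ℕ∞ | ∃ (i : ℕ) (M : ModuleCat.{0} (GA k Q rel)), n = i ∧ extNZ i M (AModL k Q rel)}

/-- the right global dimension of `A`: `sup { i : Ext^i(M, N) ≠ 0 }` over right modules -/
def rGlDim : ℕ∞ :=
  sSup {n : ℕ∞ | ∃ (i : ℕ) (M N : ModuleCat.{0} (GA k Q rel)ᵐᵒᵖ), n = i ∧ extNZ i M N}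

/-- the left global dimension of `A` -/
def lGlDim : ℕ∞ :=
  sSup {n : ℕ∞ | ∃ (i : ℕ) (M N : ModuleCat.{0} (GA k Q rel)), n = i ∧ extNZ i M N}

end LocGentle
namespace LocGentle

variable (k : Type) [Field k] (Q : Quiv) (rel : Q.Arr → Q.Arr → Prop)

/-- the condition (CM1): `GKdim A = depth A` -/
def SatCM1 : Prop :=
  ∃ d : ℕ, GKdim k Q rel = (d : ℝ) ∧ depth k Q rel = (d : ℕ∞)

/-- the condition (CM2): there are commuting, homogeneous, algebraically independent
elements `x₁, …, x_d ∈ A` with `d = GKdim A` such that `A` is a finitely generated free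
module over the polynomial subalgebra `k[x₁, …, x_d]`.  (Algebraic independence of the
commuting family `x` is expressed by the `k`-linear independence of the monomials in the
`xᵢ`.) -/
def SatCM2 : Prop :=
  ∃ (d : ℕ) (x : Fin d → GA k Q rel),
    GKdim k Q rel = (d : ℝ) ∧
    (∀ i j : Fin d, Commute (x i) (x j)) ∧
    (∀ i : Fin d, ∃ n : ℕ, x i ∈ deg k Q rel n) ∧
    LinearIndependent k (fun m : (Fin d →₀ ℕ) => (((List.finRange d).map fun i => x i ^ m i)).prod) ∧
    Module.Free ↥(Algebra.adjoin k (Set.range x)) (GA k Q rel) ∧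
    Module.Finite ↥(Algebra.adjoin k (Set.range x)) (GA k Q rel)

/-- the sum of all arrows of `Q` -/
def arrSum : GA k Q rel := ∑ a : Q.Arr, arr k Q rel a

end LocGentle

namespace LocGentle

/-! ### The defining relations and the spanning set of paths -/

section Relations

variable {k : Type} [Field k] {Q : Quiv} {rel : Q.Arr → Q.Arr → Prop}

theorem vtx_mul_self (v : Q.V) : vtx k Q rel v * vtx k Q rel v = vtx k Q rel v := by
  simpa [vtx] using RingQuot.mkAlgHom_rel k (GARel.idem (k := k) (rel := rel) v)

theorem vtx_mul_vtx_of_ne {v w : Q.V} (h : v ≠ w) : vtx k Q rel v * vtx k Q rel w = 0 := by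
  simpa [vtx] using RingQuot.mkAlgHom_rel k (GARel.orth (k := k) (rel := rel) v w h)

theorem sum_vtx : ∑ v : Q.V, vtx k Q rel v = 1 := by
  simpa [vtx] using RingQuot.mkAlgHom_rel k (GARel.unit (k := k) (rel := rel))

theorem vtx_src_mul_arr (a : Q.Arr) : vtx k Q rel (Q.src a) * arr k Q rel a = arr k Q rel a := by
  simpa [vtx, arr] using RingQuot.mkAlgHom_rel k (GARel.src_mul (k := k) (rel := rel) a)

theorem arr_mul_vtx_tgt (a : Q.Arr) : arr k Q rel a * vtx k Q rel (Q.tgt a) = arr k Q rel a := by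
  simpa [vtx, arr] using RingQuot.mkAlgHom_rel k (GARel.mul_tgt (k := k) (rel := rel) a)

theorem vtx_mul_arr_of_ne {v : Q.V} {a : Q.Arr} (h : v ≠ Q.src a) :
    vtx k Q rel v * arr k Q rel a = 0 := by
  simpa [vtx, arr] using RingQuot.mkAlgHom_rel k (GARel.src_zero (k := k) (rel := rel) v a h)

theorem arr_mul_vtx_of_ne {v : Q.V} {a : Q.Arr} (h : v ≠ Q.tgt a) :
    arr k Q rel a * vtx k Q rel v = 0 := by
  simpa [vtx, arr] using RingQuot.mkAlgHom_rel k (GARel.tgt_zero (k := k) (rel := rel) v a h)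

/-- `Follows rel a b` says that `ab` is a basis path of length two. -/
def Follows (rel : Q.Arr → Q.Arr → Prop) (a b : Q.Arr) : Prop := Q.tgt a = Q.src b ∧ ¬ rel a b

theorem allowedWord_cons_cons {a b : Q.Arr} {l : List Q.Arr} :
    AllowedWord rel (a :: b :: l) ↔ Follows rel a b ∧ AllowedWord rel (b :: l) :=
  List.isChain_cons_cons

theorem allowedWord_singleton (a : Q.Arr) : AllowedWord rel [a] := List.isChain_singleton a

theorem arr_mul_arr_of_not_follows {a b : Q.Arr} (h : ¬ Follows rel a b) :
    arr k Q rel a * arr k Q rel b = 0 := by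
  by_cases h' : Q.tgt a = Q.src b
  · have hr : rel a b := by_contra fun hn => h ⟨h', hn⟩
    simpa [vtx, arr] using RingQuot.mkAlgHom_rel k (GARel.rel_zero (k := k) (rel := rel) a b hr)
  · rw [← arr_mul_vtx_tgt a, mul_assoc, vtx_mul_arr_of_ne h', mul_zero]

@[simp] theorem wordEl_nil : wordEl k Q rel [] = 1 := rfl

@[simp] theorem wordEl_cons (a : Q.Arr) (l : List Q.Arr) :
    wordEl k Q rel (a :: l) = arr k Q rel a * wordEl k Q rel l := by
  simp [wordEl]

/-- A subspace containing `1` and closed under left multiplication by vertices and arrows is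
everything. -/
theorem eq_top_of_mul_mem {M : Submodule k (GA k Q rel)} (h1 : 1 ∈ M)
    (hv : ∀ v, ∀ y ∈ M, vtx k Q rel v * y ∈ M) (ha : ∀ a, ∀ y ∈ M, arr k Q rel a * y ∈ M) :
    M = ⊤ := by
  have key : ∀ z : FreeAlgebra k (Q.V ⊕ Q.Arr), ∀ y ∈ M,
      RingQuot.mkAlgHom k (GARel k Q rel) z * y ∈ M := by
    intro z
    induction z using FreeAlgebra.induction with
    | grade0 r =>
      intro y hy
      rw [AlgHom.commutes, ← Algebra.smul_def]
      exact M.smul_mem _ hy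
    | grade1 x =>
      cases x with
      | inl v => exact hv v
      | inr a => exact ha a
    | mul a b iha ihb =>
      intro y hy
      rw [map_mul, mul_assoc]
      exact iha _ (ihb _ hy)
    | add a b iha ihb =>
      intro y hy
      rw [map_add, add_mul]
      exact M.add_mem (iha _ hy) (ihb _ hy)
  refine eq_top_iff.2 fun y _ => ?_
  obtain ⟨z, rfl⟩ := RingQuot.mkAlgHom_surjective k (GARel k Q rel) y
  simpa using key z 1 h1

end Relations

/-! ### Homogeneous components -/

section Degree

variable {k : Type} [Field k] {Q : Quiv} {rel : Q.Arr → Q.Arr → Prop}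

/-- The stationary path at a vertex. -/
def Pth.stationary (v : Q.V) : Pth Q := ⟨v, [], by simp, List.isChain_nil⟩

/-- The path given by a nonempty allowed word. -/
def Pth.ofWord (a : Q.Arr) (l : List Q.Arr) (h : AllowedWord rel (a :: l)) : Pth Q :=
  ⟨Q.src a, a :: l, by simp, List.IsChain.imp (fun _ _ h => h.1) h⟩

theorem vtx_mem_deg (v : Q.V) : vtx k Q rel v ∈ deg k Q rel 0 :=
  Submodule.subset_span ⟨Pth.stationary v, List.isChain_nil, rfl, by
    simp [Pth.el, Pth.stationary]⟩

theorem wordEl_mem_deg {a : Q.Arr} {l : List Q.Arr} (h : AllowedWord rel (a :: l)) :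
    wordEl k Q rel (a :: l) ∈ deg k Q rel (l.length + 1) :=
  Submodule.subset_span ⟨Pth.ofWord a l h, h, rfl, by
    simp [Pth.el, Pth.ofWord, ← mul_assoc, vtx_src_mul_arr]⟩

theorem one_mem_deg : (1 : GA k Q rel) ∈ deg k Q rel 0 := by
  rw [← sum_vtx]
  exact Submodule.sum_mem _ fun v _ => vtx_mem_deg v

theorem arr_mul_mem_deg (a : Q.Arr) {n : ℕ} {y : GA k Q rel} (hy : y ∈ deg k Q rel n) :
    arr k Q rel a * y ∈ deg k Q rel (n + 1) := by
  induction hy using Submodule.span_induction with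
  | zero => simp
  | add x y _ _ hx hy => rw [mul_add]; exact Submodule.add_mem _ hx hy
  | smul c x _ hx => rw [mul_smul_comm]; exact Submodule.smul_mem _ _ hx
  | mem x hx =>
    obtain ⟨⟨s, w, hs, hc⟩, hp, rfl, rfl⟩ := hx
    simp only [Pth.el, Pth.len, Pth.Allowed] at *
    by_cases hv : s = Q.tgt a
    · subst hv
      rw [← mul_assoc, arr_mul_vtx_tgt, ← wordEl_cons]
      cases w with
      | nil => exact wordEl_mem_deg (allowedWord_singleton a)
      | cons b w =>
        by_cases hf : Follows rel a b
        · exact wordEl_mem_deg (allowedWord_cons_cons.2 ⟨hf, hp⟩)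
        · rw [wordEl_cons, wordEl_cons, ← mul_assoc, arr_mul_arr_of_not_follows hf, zero_mul]
          exact Submodule.zero_mem _
    · rw [← mul_assoc, arr_mul_vtx_of_ne hv, zero_mul]
      exact Submodule.zero_mem _

theorem arrSum_mul_mem_deg {n : ℕ} {y : GA k Q rel} (hy : y ∈ deg k Q rel n) :
    arrSum k Q rel * y ∈ deg k Q rel (n + 1) := by
  rw [arrSum, Finset.sum_mul]
  exact Submodule.sum_mem _ fun a _ => arr_mul_mem_deg a hy

theorem arrSum_pow_mem_deg (n : ℕ) : arrSum k Q rel ^ n ∈ deg k Q rel n := by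
  induction n with
  | zero => simpa using one_mem_deg
  | succ n ih => rw [pow_succ']; exact arrSum_mul_mem_deg ih

theorem deg_zero_le_range_vtx :
    deg k Q rel 0 ≤ Submodule.span k (Set.range (vtx k Q rel)) := by
  refine Submodule.span_le.2 ?_
  rintro _ ⟨p, -, hp, rfl⟩
  have hw : p.w = [] := List.length_eq_zero_iff.1 hp
  exact Submodule.subset_span ⟨p.s, by simp [Pth.el, hw]⟩

instance : FiniteDimensional k (deg k Q rel 0) :=
  have := FiniteDimensional.span_of_finite k (Set.finite_range (vtx k Q rel))
  Submodule.finiteDimensional_of_le deg_zero_le_range_vtx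

theorem mul_mem_deg_zero {x y : GA k Q rel} (hx : x ∈ deg k Q rel 0) (hy : y ∈ deg k Q rel 0) :
    x * y ∈ deg k Q rel 0 := by
  have hle : deg k Q rel 0 * deg k Q rel 0 ≤ deg k Q rel 0 := by
    refine (mul_le_mul' deg_zero_le_range_vtx deg_zero_le_range_vtx).trans ?_
    rw [Submodule.span_mul_span]
    refine Submodule.span_le.2 ?_
    rintro _ ⟨_, ⟨v, rfl⟩, _, ⟨w, rfl⟩, rfl⟩
    by_cases h : v = w
    · subst h
      simpa [vtx_mul_self] using vtx_mem_deg v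
    · simp [vtx_mul_vtx_of_ne h]
  exact hle (Submodule.mul_mem_mul hx hy)

theorem not_linearIndependent_pow_of_mem_deg_zero {x : GA k Q rel} (hx : x ∈ deg k Q rel 0) :
    ¬ LinearIndependent k (fun n : ℕ => x ^ n) := by
  intro h
  have hmem : ∀ n : ℕ, x ^ n ∈ deg k Q rel 0 := by
    intro n
    induction n with
    | zero => simpa using one_mem_deg
    | succ n ih => rw [pow_succ]; exact mul_mem_deg_zero ih hx
  have h' : LinearIndependent k (fun n : ℕ => (⟨x ^ n, hmem n⟩ : deg k Q rel 0)) :=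
    LinearIndependent.of_comp (deg k Q rel 0).subtype h
  exact not_finite_iff_infinite.2 inferInstance h'.finite

theorem wordEl_mul_eq_zero {y : GA k Q rel} (hy : ∀ a, arr k Q rel a * y = 0) {l : List Q.Arr}
    (hl : l ≠ []) : wordEl k Q rel l * y = 0 := by
  induction l with
  | nil => exact absurd rfl hl
  | cons a l ih =>
    rw [wordEl_cons, mul_assoc]
    rcases eq_or_ne l [] with rfl | h
    · simpa using hy a
    · rw [ih h, mul_zero]

theorem mul_eq_zero_of_mem_deg {y : GA k Q rel} (hy : ∀ a, arr k Q rel a * y = 0) {n : ℕ}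
    (hn : n ≠ 0) {x : GA k Q rel} (hx : x ∈ deg k Q rel n) : x * y = 0 := by
  induction hx using Submodule.span_induction with
  | zero => simp
  | add x y _ _ hx hy => rw [add_mul, hx, hy, add_zero]
  | smul c x _ hx => rw [smul_mul_assoc, hx, smul_zero]
  | mem x hx =>
    obtain ⟨p, -, hp, rfl⟩ := hx
    rw [Pth.el, mul_assoc, wordEl_mul_eq_zero hy, mul_zero]
    rintro h
    exact hn (by rw [← hp, Pth.len, h, List.length_nil])

theorem arr_mul_wordEl_of_leftMaxWord {l : List Q.Arr} (hl : LeftMaxWord rel l) (a : Q.Arr) :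
    arr k Q rel a * wordEl k Q rel l = 0 := by
  obtain ⟨hne, hal, hmax⟩ := hl
  cases l with
  | nil => exact absurd rfl hne
  | cons b l =>
    rw [wordEl_cons, ← mul_assoc, arr_mul_arr_of_not_follows, zero_mul]
    exact fun h => hmax a (allowedWord_cons_cons.2 ⟨h, hal⟩)

end Degree

end LocGentle

namespace LocGentle

/-! ### Growth -/

section Growth

variable {k : Type} [Field k] {Q : Quiv} {rel : Q.Arr → Q.Arr → Prop}

theorem IsGentleRel.follows_right_unique (hg : IsGentleRel Q rel) {a b c : Q.Arr}
    (hb : Follows rel a b) (hc : Follows rel a c) : b = c := by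
  by_contra hne
  rcases hg.cond_iii a b c hne hb.1 hc.1 with h | h
  · exact hb.2 h.1
  · exact hc.2 h.1

theorem IsGentleRel.follows_left_unique (hg : IsGentleRel Q rel) {a b c : Q.Arr}
    (hb : Follows rel b a) (hc : Follows rel c a) : b = c := by
  by_contra hne
  rcases hg.cond_ii a b c hne hb.1 hc.1 with h | h
  · exact hb.2 h.1
  · exact hc.2 h.1

theorem IsGentleRel.allowedWord_unique (hg : IsGentleRel Q rel) :
    ∀ {l l' : List Q.Arr} {a : Q.Arr}, AllowedWord rel (a :: l) → AllowedWord rel (a :: l') →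
      l.length = l'.length → l = l'
  | [], [], _, _, _, _ => rfl
  | b :: l, c :: l', a, h, h', hlen => by
    rw [allowedWord_cons_cons] at h h'
    obtain rfl := hg.follows_right_unique h.1 h'.1
    rw [hg.allowedWord_unique h.2 h'.2 (by simpa using hlen)]

/-- The first arrow of a path, or the vertex of a stationary path. -/
def Pth.start (p : Pth Q) : Q.Arr ⊕ Q.V := p.w.head?.elim (Sum.inr p.s) Sum.inl

theorem IsGentleRel.pth_eq (hg : IsGentleRel Q rel) {p q : Pth Q} (hp : p.Allowed rel)
    (hq : q.Allowed rel) (hlen : p.len = q.len) (hstart : p.start = q.start) : p = q := by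
  obtain ⟨s, w, hs, hc⟩ := p
  obtain ⟨s', w', hs', hc'⟩ := q
  simp only [Pth.Allowed, Pth.len, Pth.start] at *
  cases w with
  | nil =>
    obtain rfl : w' = [] := List.length_eq_zero_iff.1 hlen.symm
    simpa using hstart
  | cons a w =>
    cases w' with
    | nil => simp at hlen
    | cons b w' =>
      obtain rfl : a = b := by simpa using hstart
      obtain rfl := hg.allowedWord_unique hp hq (by simpa using hlen)
      obtain rfl : s = s' := (hs a rfl).symm.trans (hs' a rfl)
      rfl

variable (k) in
/-- The unique basis path with prescribed length and start, or zero if there is none. -/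
def basisPath (rel : Q.Arr → Q.Arr → Prop) (n : ℕ) (s : Q.Arr ⊕ Q.V) : GA k Q rel :=
  open Classical in
  if h : ∃ p : Pth Q, p.Allowed rel ∧ p.len = n ∧ p.start = s then h.choose.el k rel else 0

theorem IsGentleRel.basisPath_eq (hg : IsGentleRel Q rel) {p : Pth Q} (hp : p.Allowed rel) :
    basisPath k rel p.len p.start = p.el k rel := by
  have h : ∃ q : Pth Q, q.Allowed rel ∧ q.len = p.len ∧ q.start = p.start := ⟨p, hp, rfl, rfl⟩
  rw [basisPath, dif_pos h,
    hg.pth_eq h.choose_spec.1 hp h.choose_spec.2.1 h.choose_spec.2.2]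

theorem IsGentleRel.iSup_deg_le (hg : IsGentleRel Q rel) (n : ℕ) :
    ⨆ i ∈ Finset.range (n + 1), deg k Q rel i ≤ Submodule.span k
      (Set.range fun x : Fin (n + 1) × (Q.Arr ⊕ Q.V) => basisPath k rel x.1 x.2) := by
  refine iSup₂_le fun i hi => Submodule.span_le.2 ?_
  rintro _ ⟨p, hp, rfl, rfl⟩
  exact Submodule.subset_span ⟨(⟨p.len, Finset.mem_range.1 hi⟩, p.start), hg.basisPath_eq hp⟩

theorem IsGentleRel.finiteDimensional_iSup_deg (hg : IsGentleRel Q rel) (n : ℕ) :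
    FiniteDimensional k ↥(⨆ i ∈ Finset.range (n + 1), deg k Q rel i) :=
  have := FiniteDimensional.span_of_finite k
    (Set.finite_range fun x : Fin (n + 1) × (Q.Arr ⊕ Q.V) => basisPath k rel x.1 x.2)
  Submodule.finiteDimensional_of_le (hg.iSup_deg_le n)

theorem IsGentleRel.finrank_iSup_deg_le (hg : IsGentleRel Q rel) (n : ℕ) :
    Module.finrank k ↥(⨆ i ∈ Finset.range (n + 1), deg k Q rel i) ≤
      (n + 1) * Fintype.card (Q.Arr ⊕ Q.V) := by
  have := FiniteDimensional.span_of_finite k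
    (Set.finite_range fun x : Fin (n + 1) × (Q.Arr ⊕ Q.V) => basisPath k rel x.1 x.2)
  refine (Submodule.finrank_mono (hg.iSup_deg_le n)).trans ?_
  refine (finrank_range_le_card _).trans_eq ?_
  simp

theorem tendsto_log_linear_div_log {c : ℝ} (hc : 0 < c) :
    Filter.Tendsto (fun n : ℕ => Real.log ((n + 1) * c) / Real.log n) Filter.atTop (nhds 1) := by
  have hlog : Filter.Tendsto (fun n : ℕ => Real.log n) Filter.atTop Filter.atTop :=
    Real.tendsto_log_atTop.comp tendsto_natCast_atTop_atTop
  have h1 : Filter.Tendsto (fun n : ℕ => Real.log ((1 + 1 / (n : ℝ)) * c)) Filter.atTop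
      (nhds (Real.log c)) := by
    have h0 : Filter.Tendsto (fun n : ℕ => (1 + 1 / (n : ℝ)) * c) Filter.atTop (nhds c) := by
      simpa using (tendsto_one_div_atTop_nhds_zero_nat.const_add (1 : ℝ)).mul_const c
    exact (Real.continuousAt_log hc.ne').tendsto.comp h0
  have h2 : Filter.Tendsto
      (fun n : ℕ => 1 + Real.log ((1 + 1 / (n : ℝ)) * c) / Real.log n) Filter.atTop (nhds 1) := by
    simpa using (h1.div_atTop hlog).const_add (1 : ℝ)
  refine h2.congr' ?_
  filter_upwards [Filter.eventually_gt_atTop 1] with n hn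
  have hn' : (1 : ℝ) < n := by exact_mod_cast hn
  have hpos : 0 < Real.log n := Real.log_pos hn'
  have hsplit : ((n : ℝ) + 1) * c = n * ((1 + 1 / (n : ℝ)) * c) := by
    field_simp
  rw [hsplit, Real.log_mul (x := n) (by positivity) (by positivity), add_div,
    div_self hpos.ne']

theorem IsGentleRel.log_finrank_div_log_le (hg : IsGentleRel Q rel) (n : ℕ) :
    Real.log (Module.finrank k ↥(⨆ i ∈ Finset.range (n + 1), deg k Q rel i)) / Real.log n ≤
      Real.log ((n + 1) * (Fintype.card (Q.Arr ⊕ Q.V) : ℝ)) / Real.log n := by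
  refine div_le_div_of_nonneg_right ?_ (Real.log_natCast_nonneg n)
  rcases Nat.eq_zero_or_pos
    (Module.finrank k ↥(⨆ i ∈ Finset.range (n + 1), deg k Q rel i)) with h | h
  · rw [h, Nat.cast_zero, Real.log_zero]
    exact_mod_cast Real.log_natCast_nonneg ((n + 1) * Fintype.card (Q.Arr ⊕ Q.V))
  · exact Real.log_le_log (by exact_mod_cast h) (by exact_mod_cast hg.finrank_iSup_deg_le n)

theorem IsGentleRel.GKdim_le_one (hg : IsGentleRel Q rel) : GKdim k Q rel ≤ 1 := by
  have ht := tendsto_log_linear_div_log (c := Fintype.card (Q.Arr ⊕ Q.V))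
    (by exact_mod_cast Fintype.card_pos)
  rw [← ht.limsup_eq]
  refine Filter.limsup_le_limsup (.of_forall fun n => hg.log_finrank_div_log_le n) ?_
    ht.isBoundedUnder_le
  exact Filter.IsCoboundedUnder.of_frequently_ge (a := 0) <| .of_forall fun n =>
    div_nonneg (Real.log_natCast_nonneg _) (Real.log_natCast_nonneg _)

theorem IsGentleRel.GKdim_eq_one (hg : IsGentleRel Q rel)
    (hx : LinearIndependent k fun n : ℕ => arrSum k Q rel ^ n) : GKdim k Q rel = 1 := by
  refine (tendsto_of_tendsto_of_tendsto_of_le_of_le (tendsto_log_linear_div_log one_pos)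
    (tendsto_log_linear_div_log (c := Fintype.card (Q.Arr ⊕ Q.V))
      (by exact_mod_cast Fintype.card_pos)) (fun n => ?_)
    fun n => hg.log_finrank_div_log_le n).limsup_eq
  refine div_le_div_of_nonneg_right (Real.log_le_log (by positivity) ?_)
    (Real.log_natCast_nonneg n)
  have := hg.finiteDimensional_iSup_deg (k := k) n
  have hmem : ∀ i : Fin (n + 1),
      arrSum k Q rel ^ (i : ℕ) ∈ ⨆ i ∈ Finset.range (n + 1), deg k Q rel i := fun i =>
    Submodule.mem_iSup_of_mem (i : ℕ) <|
      Submodule.mem_iSup_of_mem (Finset.mem_range.2 i.2) (arrSum_pow_mem_deg _)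
  have hli : LinearIndependent k fun i : Fin (n + 1) =>
      (⟨arrSum k Q rel ^ (i : ℕ), hmem i⟩ : ↥(⨆ i ∈ Finset.range (n + 1), deg k Q rel i)) :=
    LinearIndependent.of_comp (Submodule.subtype _) (hx.comp _ Fin.val_injective)
  have := hli.fintype_card_le_finrank
  rw [Fintype.card_fin] at this
  rw [mul_one]
  exact_mod_cast this

end Growth

/-! ### Algebras without finite maximal paths -/

section NoFiniteMax

variable {Q : Quiv} {rel : Q.Arr → Q.Arr → Prop}

theorem allowedWord_concat {l : List Q.Arr} {b c : Q.Arr} (h : AllowedWord rel (l ++ [b]))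
    (hbc : Follows rel b c) : AllowedWord rel (l ++ [b] ++ [c]) := by
  refine List.isChain_append.2 ⟨h, List.isChain_singleton c, ?_⟩
  simpa using And.intro hbc.1 hbc.2

theorem allowedWord_of_reflTransGen {a c : Q.Arr} (h : Relation.ReflTransGen (Follows rel) a c) :
    ∃ l, AllowedWord rel (l ++ [c]) ∧ (l ++ [c]).head? = some a := by
  induction h with
  | refl => exact ⟨[], allowedWord_singleton a, rfl⟩
  | @tail b c _ hbc ih =>
    obtain ⟨l, hl, ha⟩ := ih
    exact ⟨l ++ [b], allowedWord_concat hl hbc, by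
      rw [List.head?_append, ha, Option.some_or]⟩

theorem exists_follows_left (hg : IsGentleRel Q rel)
    (hmax : ¬ ∃ l : List Q.Arr, FiniteMaxWord rel l) (a : Q.Arr) : ∃ b, Follows rel b a := by
  by_contra! hno
  let R : Set Q.Arr := {c | Relation.ReflTransGen (Follows rel) a c}
  have hsucc : ∀ c : R, ∃ d : R, Follows rel c d := by
    rintro ⟨c, hc⟩
    by_contra! hc'
    obtain ⟨l, hl, ha⟩ := allowedWord_of_reflTransGen hc
    refine hmax ⟨l ++ [c], ⟨by simp, hl, fun d hd => ?_⟩, by simp, hl, fun b hb => ?_⟩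
    · have hcd : Follows rel c d := (List.isChain_append.1 hd).2.2 c (by simp) d (by simp)
      exact hc' ⟨d, hc.tail hcd⟩ hcd
    · exact hno b ((List.isChain_cons.1 hb).1 a ha)
  choose f hf using hsucc
  have hinj : Function.Injective f := fun b c hbc =>
    Subtype.ext (hg.follows_left_unique (hf b) (hbc ▸ hf c))
  obtain ⟨b, hb⟩ := Finite.surjective_of_injective hinj ⟨a, Relation.ReflTransGen.refl⟩
  have := hf b
  rw [hb] at this
  exact hno b this

theorem exists_perm_follows (hg : IsGentleRel Q rel)
    (hmax : ¬ ∃ l : List Q.Arr, FiniteMaxWord rel l) :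
    ∃ f : Equiv.Perm Q.Arr, ∀ a b, Follows rel a b ↔ f a = b := by
  choose g hgf using exists_follows_left hg hmax
  have hinj : Function.Injective g := fun b c hbc =>
    hg.follows_right_unique (hgf b) (hbc ▸ hgf c)
  let e := Equiv.ofBijective g (Finite.injective_iff_bijective.1 hinj)
  refine ⟨e.symm, fun a b => ?_⟩
  rw [Equiv.symm_apply_eq]
  exact ⟨fun h => hg.follows_left_unique h (hgf b), fun h => h ▸ hgf b⟩

theorem exists_src_eq {f : Equiv.Perm Q.Arr} (hf : ∀ a b, Follows rel a b ↔ f a = b) (v : Q.V) :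
    ∃ a, Q.src a = v := by
  rcases subsingleton_or_nontrivial Q.V with h | h
  · exact ⟨Classical.arbitrary _, Subsingleton.elim _ _⟩
  · obtain ⟨w, -, ⟨a, ha, -⟩ | ⟨a, -, ha⟩⟩ := Q.connected.preconnected.exists_adj_of_nontrivial v
    · exact ⟨a, ha⟩
    · exact ⟨f a, by rw [← ((hf a _).2 rfl).1, ha]⟩

end NoFiniteMax

end LocGentle

namespace LocGentle

/-! ### A graded matrix representation -/

section Representation

open Polynomial

variable {k : Type} [Field k] {Q : Quiv} {rel : Q.Arr → Q.Arr → Prop}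

/-- The vertex at which the remaining part of a path starts. -/
def startVertex : Q.Arr ⊕ Q.V → Q.V := Sum.elim Q.src id

/-- The arrow following `a` on the maximal path through `a`, or the target of `a` if that path
ends with `a`. -/
def next (rel : Q.Arr → Q.Arr → Prop) (a : Q.Arr) : Q.Arr ⊕ Q.V :=
  open Classical in if h : ∃ b, Follows rel a b then Sum.inl h.choose else Sum.inr (Q.tgt a)

theorem startVertex_next (a : Q.Arr) : startVertex (next rel a) = Q.tgt a := by
  unfold next
  split_ifs with h
  · exact h.choose_spec.1.symm
  · rfl

theorem next_ne_of_rel {a b : Q.Arr} (h : rel a b) : next rel a ≠ Sum.inl b := by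
  unfold next
  split_ifs with h'
  · intro he
    exact h'.choose_spec.2 (Sum.inl_injective he ▸ h)
  · exact Sum.inr_ne_inl

theorem IsGentleRel.next_eq (hg : IsGentleRel Q rel) {a b : Q.Arr} (h : Follows rel a b) :
    next rel a = Sum.inl b := by
  have h' : ∃ b, Follows rel a b := ⟨b, h⟩
  rw [next, dif_pos h', hg.follows_right_unique h'.choose_spec h]

variable (k Q rel) in
/-- The values of `matrixRep` on the generators. -/
def matrixRepGen : Q.V ⊕ Q.Arr → Matrix (Q.Arr ⊕ Q.V) (Q.Arr ⊕ Q.V) k[X] :=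
  Sum.elim (fun v => Matrix.diagonal fun s => if startVertex s = v then 1 else 0)
    (fun a => Matrix.single (Sum.inl a) (next rel a) X)

theorem matrixRepGen_rel ⦃x y : FreeAlgebra k (Q.V ⊕ Q.Arr)⦄ (h : GARel k Q rel x y) :
    FreeAlgebra.lift k (matrixRepGen k Q rel) x = FreeAlgebra.lift k (matrixRepGen k Q rel) y := by
  induction h with
  | idem v => simp [matrixRepGen]
  | orth v w hvw =>
    simp only [matrixRepGen, map_mul, FreeAlgebra.lift_ι_apply, Sum.elim_inl,
      Matrix.diagonal_mul_diagonal, map_zero]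
    refine Matrix.diagonal_eq_zero.2 (funext fun s => ?_)
    by_cases h : startVertex s = v
    · simp [h, hvw]
    · simp [h]
  | unit =>
    ext s t
    simp [matrixRepGen, Matrix.sum_apply, Matrix.diagonal_apply, Matrix.one_apply]
  | src_mul a =>
    ext s t
    simp only [matrixRepGen, map_mul, FreeAlgebra.lift_ι_apply, Sum.elim_inl, Sum.elim_inr,
      Matrix.diagonal_mul, Matrix.single_apply]
    split_ifs with h h' h'
    · simp
    · simp
    · exact absurd (by rw [← h'.1]; rfl) h
    · simp
  | mul_tgt a =>
    ext s t
    simp only [matrixRepGen, map_mul, FreeAlgebra.lift_ι_apply, Sum.elim_inl, Sum.elim_inr,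
      Matrix.mul_diagonal, Matrix.single_apply]
    split_ifs with h h'
    · simp
    · exact absurd (h.2 ▸ startVertex_next a) h'
    all_goals simp
  | src_zero v a hv =>
    ext s t
    simp only [matrixRepGen, map_mul, FreeAlgebra.lift_ι_apply, Sum.elim_inl, Sum.elim_inr,
      Matrix.diagonal_mul, Matrix.single_apply, map_zero, Matrix.zero_apply]
    split_ifs with h h'
    · exact absurd (h.symm.trans (by rw [← h'.1]; rfl)) hv
    all_goals simp
  | tgt_zero v a hv =>
    ext s t
    simp only [matrixRepGen, map_mul, FreeAlgebra.lift_ι_apply, Sum.elim_inl, Sum.elim_inr,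
      Matrix.mul_diagonal, Matrix.single_apply, map_zero, Matrix.zero_apply]
    split_ifs with h h'
    · exact absurd (h'.symm.trans (h.2 ▸ startVertex_next a)) hv
    all_goals simp
  | rel_zero a b hab =>
    simp [matrixRepGen, Matrix.single_mul_single_of_ne _ _ _ _ (next_ne_of_rel hab)]

variable (k Q rel) in
/-- A graded matrix representation: a path moves its start to its continuation, weighted by a
power of `X` recording its length. -/
def matrixRep : GA k Q rel →ₐ[k] Matrix (Q.Arr ⊕ Q.V) (Q.Arr ⊕ Q.V) k[X] :=
  RingQuot.liftAlgHom k ⟨FreeAlgebra.lift k (matrixRepGen k Q rel), matrixRepGen_rel⟩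

theorem matrixRep_vtx (v : Q.V) : matrixRep k Q rel (vtx k Q rel v) =
    Matrix.diagonal fun s => if startVertex s = v then 1 else 0 := by
  simp [matrixRep, vtx, matrixRepGen]

theorem matrixRep_arr (a : Q.Arr) :
    matrixRep k Q rel (arr k Q rel a) = Matrix.single (Sum.inl a) (next rel a) X := by
  simp [matrixRep, arr, matrixRepGen]

theorem IsGentleRel.matrixRep_wordEl (hg : IsGentleRel Q rel) :
    ∀ {l : List Q.Arr} {a : Q.Arr}, AllowedWord rel (a :: l) →
      ∃ s, matrixRep k Q rel (wordEl k Q rel (a :: l)) =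
        Matrix.single (Sum.inl a) s (X ^ (l.length + 1))
  | [], a, _ => ⟨next rel a, by simp [matrixRep_arr]⟩
  | b :: l, a, h => by
    rw [allowedWord_cons_cons] at h
    obtain ⟨s, hs⟩ := hg.matrixRep_wordEl h.2
    refine ⟨s, ?_⟩
    rw [wordEl_cons, map_mul, hs, matrixRep_arr, hg.next_eq h.1, Matrix.single_mul_single_same,
      ← pow_succ', List.length_cons]

theorem IsGentleRel.wordEl_ne_zero (hg : IsGentleRel Q rel) {l : List Q.Arr}
    (hl : AllowedWord rel l) (hne : l ≠ []) : wordEl k Q rel l ≠ 0 := by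
  cases l with
  | nil => exact absurd rfl hne
  | cons a l =>
    obtain ⟨s, hs⟩ := hg.matrixRep_wordEl (k := k) hl
    intro h
    rw [h, map_zero] at hs
    have := congrFun₂ hs (Sum.inl a) s
    rw [Matrix.single_apply_same] at this
    exact pow_ne_zero _ X_ne_zero this.symm

end Representation

/-! ### The module structure over the subalgebra generated by the sum of the arrows -/

theorem free_and_finite_of_ringEquiv {R S M N : Type*} [Semiring R] [Semiring S] [AddCommMonoid M]
    [AddCommMonoid N] [Module R M] [Module S N] [Module.Free S N] [Module.Finite S N] (e : R ≃+* S)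
    (g : M ≃+ N) (hg : ∀ (r : R) (m : M), g (r • m) = e r • g m) :
    Module.Free R M ∧ Module.Finite R M := by
  have := RingHomInvPair.of_ringEquiv e
  have := RingHomInvPair.of_ringEquiv e.symm
  let E : M ≃ₛₗ[(e : R →+* S)] N := { g with map_smul' := hg }
  exact ⟨Module.Free.of_equiv E.symm,
    Module.Finite.of_surjective E.symm.toLinearMap E.symm.surjective⟩

section Periodic

open Polynomial

variable {k : Type} [Field k] {Q : Quiv} {rel : Q.Arr → Q.Arr → Prop}

variable (k Q rel) in
/-- The sum of the rows of `matrixRep` indexed by arrows. -/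
def rowSum : GA k Q rel →ₗ[k] (Q.Arr ⊕ Q.V → k[X]) where
  toFun y := Matrix.vecMul (Sum.elim 1 0) (matrixRep k Q rel y)
  map_add' y z := by rw [map_add, Matrix.vecMul_add]
  map_smul' c y := by rw [map_smul, Matrix.vecMul_smul, RingHom.id_apply]

theorem rowSum_apply (y : GA k Q rel) (s : Q.Arr ⊕ Q.V) :
    rowSum k Q rel y s = ∑ a, matrixRep k Q rel y (Sum.inl a) s := by
  simp [rowSum, Matrix.vecMul, dotProduct, Fintype.sum_sum_type]

theorem rowSum_mul (y z : GA k Q rel) :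
    rowSum k Q rel (y * z) = Matrix.vecMul (rowSum k Q rel y) (matrixRep k Q rel z) := by
  simp [rowSum, Matrix.vecMul_vecMul]

theorem rowSum_one : rowSum k Q rel 1 = Sum.elim (1 : Q.Arr → k[X]) (0 : Q.V → k[X]) := by
  simp [rowSum]

theorem rowSum_vtx (v : Q.V) (a : Q.Arr) :
    rowSum k Q rel (vtx k Q rel v) (Sum.inl a) = if Q.src a = v then 1 else 0 := by
  rw [← one_mul (vtx k Q rel v), rowSum_mul, rowSum_one, matrixRep_vtx, Matrix.vecMul_diagonal]
  exact one_mul _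

theorem rowSum_arr (a : Q.Arr) : rowSum k Q rel (arr k Q rel a) = Pi.single (next rel a) X := by
  ext1 s
  rw [rowSum_apply, Finset.sum_eq_single a]
  · simp [matrixRep_arr, Matrix.single_apply, Pi.single_apply, eq_comm]
  · intro b _ hb
    simp [matrixRep_arr, hb.symm]
  · simp

variable {f : Equiv.Perm Q.Arr} (hf : ∀ a b, Follows rel a b ↔ f a = b)

include hf

theorem next_eq_of_perm (a : Q.Arr) : next rel a = Sum.inl (f a) := by
  have h : ∃ b, Follows rel a b := ⟨f a, (hf a _).2 rfl⟩
  rw [next, dif_pos h, ← (hf a _).1 h.choose_spec]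

theorem rowSum_arrSum : rowSum k Q rel (arrSum k Q rel) = (X : k[X]) • rowSum k Q rel 1 := by
  ext1 s
  rw [arrSum, map_sum, Finset.sum_apply, rowSum_one, Pi.smul_apply]
  simp only [rowSum_arr, next_eq_of_perm hf]
  rw [Equiv.sum_comp f fun a => (Pi.single (Sum.inl a) X : Q.Arr ⊕ Q.V → k[X]) s]
  cases s <;> simp [Pi.single_apply]

theorem rowSum_arrSum_mul (y : GA k Q rel) :
    rowSum k Q rel (arrSum k Q rel * y) = (X : k[X]) • rowSum k Q rel y := by
  rw [rowSum_mul, rowSum_arrSum hf, Matrix.smul_vecMul, ← rowSum_mul, one_mul]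

theorem rowSum_aeval_mul (p : k[X]) (y : GA k Q rel) :
    rowSum k Q rel (aeval (arrSum k Q rel) p * y) = p • rowSum k Q rel y := by
  induction p using Polynomial.induction_on' generalizing y with
  | add p q hp hq => rw [map_add, add_mul, map_add, hp, hq, add_smul]
  | monomial n c =>
    rw [← C_mul_X_pow_eq_monomial, map_mul (aeval _), aeval_C, map_pow, aeval_X, mul_smul,
      mul_assoc, ← Algebra.smul_def, map_smul, ← algebraMap_eq, algebraMap_smul]
    congr 1
    induction n with
    | zero => simp
    | succ n ih => rw [pow_succ', mul_assoc, rowSum_arrSum_mul hf, ih, pow_succ', mul_smul]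

theorem aeval_arrSum_injective : Function.Injective (aeval (R := k) (arrSum k Q rel)) := by
  rw [injective_iff_map_eq_zero]
  intro p hp
  have h := rowSum_aeval_mul hf p 1
  rw [hp, zero_mul, map_zero, rowSum_one] at h
  simpa using (congrFun h (Sum.inl (Classical.arbitrary _))).symm

omit hf in
variable (k rel f) in
/-- The path of length `n + 1` starting with `a`. -/
def orbitPath (a : Q.Arr) (n : ℕ) : GA k Q rel := wordEl k Q rel (List.iterate f a (n + 1))

omit hf in
variable (k rel f) in
/-- The paths: stationary ones, and one for each initial arrow and length. -/
def pathFamily : Q.V ⊕ Q.Arr × ℕ → GA k Q rel :=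
  Sum.elim (vtx k Q rel) fun x => orbitPath k rel f x.1 x.2

omit hf in
theorem orbitPath_zero (a : Q.Arr) : orbitPath k rel f a 0 = arr k Q rel a := by
  simp [orbitPath]

omit hf in
theorem orbitPath_succ (a : Q.Arr) (n : ℕ) :
    orbitPath k rel f a (n + 1) = arr k Q rel a * orbitPath k rel f (f a) n := by
  simp only [orbitPath, List.iterate, wordEl_cons]

omit hf in
theorem orbitPath_eq (a : Q.Arr) (n : ℕ) : ∃ y, orbitPath k rel f a n = arr k Q rel a * y := by
  cases n with
  | zero => exact ⟨1, by rw [orbitPath_zero, mul_one]⟩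
  | succ n => exact ⟨_, orbitPath_succ a n⟩

theorem span_pathFamily : Submodule.span k (Set.range (pathFamily k rel f)) = ⊤ := by
  have hmem : ∀ i, pathFamily k rel f i ∈ Submodule.span k (Set.range (pathFamily k rel f)) :=
    fun i => Submodule.subset_span ⟨i, rfl⟩
  apply eq_top_of_mul_mem
  · rw [← sum_vtx]
    exact Submodule.sum_mem _ fun v _ => hmem (Sum.inl v)
  · intro v y hy
    induction hy using Submodule.span_induction with
    | zero => simp
    | add x y _ _ hx hy => rw [mul_add]; exact Submodule.add_mem _ hx hy
    | smul c x _ hx => rw [mul_smul_comm]; exact Submodule.smul_mem _ _ hx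
    | mem x hx =>
      obtain ⟨w | ⟨a, n⟩, rfl⟩ := hx
      · by_cases h : v = w
        · subst h
          simpa [pathFamily, vtx_mul_self] using hmem (Sum.inl v)
        · simp [pathFamily, vtx_mul_vtx_of_ne h]
      · obtain ⟨z, hz⟩ := orbitPath_eq (k := k) (rel := rel) (f := f) a n
        by_cases h : v = Q.src a
        · have := hmem (Sum.inr (a, n))
          simp only [pathFamily, Sum.elim_inr, hz] at this ⊢
          rwa [h, ← mul_assoc, vtx_src_mul_arr]
        · simp [pathFamily, hz, ← mul_assoc, vtx_mul_arr_of_ne h]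
  · intro b y hy
    induction hy using Submodule.span_induction with
    | zero => simp
    | add x y _ _ hx hy => rw [mul_add]; exact Submodule.add_mem _ hx hy
    | smul c x _ hx => rw [mul_smul_comm]; exact Submodule.smul_mem _ _ hx
    | mem x hx =>
      obtain ⟨w | ⟨a, n⟩, rfl⟩ := hx
      · by_cases h : w = Q.tgt b
        · have := hmem (Sum.inr (b, 0))
          simp only [pathFamily, Sum.elim_inr, Sum.elim_inl, orbitPath_zero] at this ⊢
          rwa [h, arr_mul_vtx_tgt]
        · simp [pathFamily, arr_mul_vtx_of_ne h]
      · by_cases h : f b = a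
        · have := hmem (Sum.inr (b, n + 1))
          simp only [pathFamily, Sum.elim_inr, orbitPath_succ] at this ⊢
          rwa [← h]
        · obtain ⟨z, hz⟩ := orbitPath_eq (k := k) (rel := rel) (f := f) a n
          simp [pathFamily, hz, ← mul_assoc, arr_mul_arr_of_not_follows ((hf b a).not.2 h)]

theorem matrixRep_orbitPath (a : Q.Arr) (n : ℕ) : matrixRep k Q rel (orbitPath k rel f a n) =
    Matrix.single (Sum.inl a) (Sum.inl ((f ^ (n + 1)) a)) (X ^ (n + 1)) := by
  induction n generalizing a with
  | zero => simp [orbitPath_zero, matrixRep_arr, next_eq_of_perm hf]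
  | succ n ih =>
    rw [orbitPath_succ, map_mul, ih, matrixRep_arr, next_eq_of_perm hf,
      Matrix.single_mul_single_same, ← pow_succ', ← Equiv.Perm.mul_apply, ← pow_succ]

theorem rowSum_orbitPath (a : Q.Arr) (n : ℕ) : rowSum k Q rel (orbitPath k rel f a n) =
    Pi.single (Sum.inl ((f ^ (n + 1)) a)) (X ^ (n + 1)) := by
  ext1 s
  rw [rowSum_apply, Finset.sum_eq_single a]
  · simp [matrixRep_orbitPath hf, Matrix.single_apply, Pi.single_apply, eq_comm]
  · intro b _ hb
    simp [matrixRep_orbitPath hf, hb.symm]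
  · simp

theorem rowSum_injective : Function.Injective (rowSum k Q rel) := by
  choose o ho using exists_src_eq hf
  rw [injective_iff_map_eq_zero]
  intro y hy
  have hspan : y ∈ Submodule.span k (Set.range (pathFamily k rel f)) := by
    rw [span_pathFamily hf]; trivial
  obtain ⟨c, rfl⟩ := Finsupp.mem_span_range_iff_exists_finsupp.1 hspan
  let pos : Q.V ⊕ Q.Arr × ℕ → Q.Arr × ℕ :=
    Sum.elim (fun v => (o v, 0)) fun x => ((f ^ (x.2 + 1)) x.1, x.2 + 1)
  have hdual : ∀ i j, (rowSum k Q rel (pathFamily k rel f i) (Sum.inl (pos j).1)).coeff (pos j).2 =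
      if i = j then 1 else 0 := by
    rintro (v | ⟨a, n⟩) (w | ⟨b, m⟩)
    · simp [pos, pathFamily, rowSum_vtx, ho, eq_comm, apply_ite (fun p : k[X] => p.coeff 0)]
    · simp only [pos, pathFamily, rowSum_vtx, Sum.elim_inl, Sum.elim_inr]
      split_ifs <;> simp_all [coeff_one]
    · simp only [pos, pathFamily, Sum.elim_inl, Sum.elim_inr, rowSum_orbitPath hf, Pi.single_apply]
      split_ifs <;> simp_all
    · simp only [pos, pathFamily, Sum.elim_inr, rowSum_orbitPath hf, Pi.single_apply]
      by_cases hnm : n = m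
      · subst hnm
        by_cases hab : a = b
        · subst hab; simp
        · simp [hab, Ne.symm hab]
      · split_ifs <;> simp_all [coeff_X_pow, eq_comm]
  suffices c = 0 by simp [this]
  ext j
  have h := congrArg (fun g : Q.Arr ⊕ Q.V → k[X] => (g (Sum.inl (pos j).1)).coeff (pos j).2) hy
  simpa [Finsupp.sum, hdual, map_sum, Finset.sum_apply, finsetSum_coeff] using h

/-- The image of `rowSum`, as a `k[X]`-submodule of a finite free module. -/
def rowSumRange : Submodule k[X] (Q.Arr ⊕ Q.V → k[X]) where
  carrier := Set.range (rowSum k Q rel)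
  add_mem' := by
    rintro _ _ ⟨y, rfl⟩ ⟨z, rfl⟩
    exact ⟨y + z, map_add _ _ _⟩
  zero_mem' := ⟨0, map_zero _⟩
  smul_mem' := by
    rintro p _ ⟨y, rfl⟩
    exact ⟨_, rowSum_aeval_mul hf p y⟩

theorem rowSum_smul {B : Subalgebra k (GA k Q rel)} {p : B} {q : k[X]}
    (h : (p : GA k Q rel) = aeval (arrSum k Q rel) q) (y : GA k Q rel) :
    rowSum k Q rel (p • y) = q • rowSum k Q rel y := by
  rw [Subalgebra.smul_def, h, smul_eq_mul, rowSum_aeval_mul hf]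

variable (k) in
/-- `rowSum` as an isomorphism onto its image. -/
def rowSumEquiv : GA k Q rel ≃+ rowSumRange (k := k) hf :=
  { Equiv.ofInjective _ (rowSum_injective hf) with
    map_add' := fun y z => Subtype.ext (map_add (rowSum k Q rel) y z) }

theorem free_and_finite_of_perm :
    Module.Free ↥(Algebra.adjoin k {arrSum k Q rel}) (GA k Q rel) ∧
      Module.Finite ↥(Algebra.adjoin k {arrSum k Q rel}) (GA k Q rel) := by
  let e : k[X] ≃ₐ[k] (aeval (R := k) (arrSum k Q rel)).range :=
    AlgEquiv.ofInjective _ (aeval_arrSum_injective hf)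
  rw [Algebra.adjoin_singleton_eq_range_aeval]
  refine free_and_finite_of_ringEquiv e.symm.toRingEquiv (rowSumEquiv k hf)
    fun p y => Subtype.ext ?_
  refine rowSum_smul hf ?_ y
  exact congrArg Subtype.val (e.apply_symm_apply p).symm
end Periodic

end LocGentle

namespace LocGentle

section CohenMacaulay

open Polynomial

variable {k : Type} [Field k] {Q : Quiv} {rel : Q.Arr → Q.Arr → Prop}

theorem linearIndependent_pow_iff_aeval_injective {x : GA k Q rel} :
    LinearIndependent k (fun n : ℕ => x ^ n) ↔ Function.Injective (aeval (R := k) x) := by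
  rw [injective_iff_map_eq_zero]
  simp [linearIndependent_iff, Finsupp.linearCombination_apply, Finsupp.sum,
    forall_iff_forall_finsupp, AddMonoidAlgebra.coeffEquiv.forall_congr_left, Polynomial.sum,
    aeval_def, eval₂_eq_sum, Algebra.smul_def]

theorem satCM2_of_perm (hg : IsGentleRel Q rel) {f : Equiv.Perm Q.Arr}
    (hf : ∀ a b, Follows rel a b ↔ f a = b) : SatCM2 k Q rel := by
  have hli : LinearIndependent k fun n : ℕ => arrSum k Q rel ^ n :=
    linearIndependent_pow_iff_aeval_injective.2 (aeval_arrSum_injective hf)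
  refine ⟨1, fun _ => arrSum k Q rel, by rw [hg.GKdim_eq_one hli, Nat.cast_one],
    fun _ _ => Commute.refl _, fun _ => ⟨1, by simpa using arrSum_pow_mem_deg 1⟩, ?_, ?_⟩
  · have hinj : Function.Injective fun m : Fin 1 →₀ ℕ => m 0 := fun m n h =>
      Finsupp.ext fun i => by rwa [Subsingleton.elim i 0]
    simpa [Function.comp_def, List.finRange_succ] using hli.comp _ hinj
  · rw [Set.range_const]
    exact free_and_finite_of_perm hf

/-- A free module over `k[x]`, with `x` transcendental, has no `x`-torsion. -/
theorem eq_zero_of_mul_eq_zero {x y : GA k Q rel}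
    (hx : Function.Injective (aeval (R := k) x))
    (hfree : Module.Free ↥(Algebra.adjoin k {x}) (GA k Q rel)) (h : x * y = 0) : y = 0 := by
  let b := Module.Free.chooseBasis ↥(Algebra.adjoin k {x}) (GA k Q rel)
  let x' : Algebra.adjoin k {x} := ⟨x, Algebra.self_mem_adjoin_singleton k x⟩
  have hxy : x' • y = 0 := h
  apply b.ext_elem
  intro i
  have hi : x' * b.repr y i = 0 := by
    have := DFunLike.congr_fun (congrArg b.repr hxy) i
    simpa using this
  obtain ⟨p, hp⟩ := (Algebra.adjoin_singleton_eq_range_aeval k x).le (b.repr y i).2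
  have hp0 : aeval x (X * p) = aeval x (0 : k[X]) := by
    rw [map_mul, aeval_X, map_zero]
    exact (congrArg (x * ·) hp).trans (congrArg Subtype.val hi)
  have : p = 0 := by simpa using hx hp0
  rw [map_zero, Finsupp.zero_apply]
  apply Subtype.ext
  rw [← hp, this]
  simp

theorem IsGentleRel.not_finiteMaxWord_of_satCM2 (hg : IsGentleRel Q rel)
    (hloc : ¬ FiniteDimensional k (GA k Q rel)) (h : SatCM2 k Q rel) (l : List Q.Arr) :
    ¬ FiniteMaxWord rel l := by
  rintro ⟨-, hl⟩
  obtain ⟨d, x, hd, -, hdeg, hli, hfree, hfin⟩ := h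
  have hd1 : d ≤ 1 := by exact_mod_cast hd ▸ hg.GKdim_le_one (k := k)
  interval_cases d
  · apply hloc
    rw [Set.range_eq_empty, Algebra.adjoin_empty] at hfin
    have : Module.Finite k (⊥ : Subalgebra k (GA k Q rel)) :=
      Module.Finite.of_surjective (Algebra.linearMap k (⊥ : Subalgebra k (GA k Q rel))) fun y =>
        (Algebra.mem_bot.1 y.2).imp fun c hc => Subtype.ext hc
    exact Module.Finite.trans (⊥ : Subalgebra k (GA k Q rel)) _
  · obtain ⟨n, hn⟩ := hdeg 0
    have hli' : LinearIndependent k fun n : ℕ => x 0 ^ n := by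
      simpa [Function.comp_def, List.finRange_succ] using
        hli.comp (fun n : ℕ => Finsupp.single 0 n) (Finsupp.single_injective 0)
    have hn0 : n ≠ 0 := by
      rintro rfl
      exact not_linearIndependent_pow_of_mem_deg_zero hn hli'
    have hrange : Set.range x = {x 0} := by
      rw [Set.range_unique]; rfl
    rw [hrange] at hfree
    exact hg.wordEl_ne_zero hl.2.1 hl.1 <|
      eq_zero_of_mul_eq_zero (linearIndependent_pow_iff_aeval_injective.1 hli') hfree
        (mul_eq_zero_of_mem_deg (arr_mul_wordEl_of_leftMaxWord hl) hn0 hn)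

end CohenMacaulay

end LocGentle

namespace LocGentle

/-- **Lemma 6.5 (lem:CMdef2).** Let `A = kQ/I` be a locally gentle algebra.  Then `A`
satisfies (CM2) if and only if `A` has no finite maximal paths; in that case `A` is a
finitely generated free module over the polynomial subalgebra `k[x]`, where
`x = ∑_{α ∈ Q₁} α` is the sum of all arrows of `Q`. -/
theorem statement18 (k : Type) [Field k] [CharZero k] (Q : Quiv)
    (rel : Q.Arr → Q.Arr → Prop) (hgentle : IsGentleRel Q rel)
    (hloc : ¬ FiniteDimensional k (GA k Q rel)) :
    (SatCM2 k Q rel ↔ ¬ ∃ l : List Q.Arr, FiniteMaxWord rel l) ∧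
    ((¬ ∃ l : List Q.Arr, FiniteMaxWord rel l) →
      Module.Free ↥(Algebra.adjoin k {arrSum k Q rel}) (GA k Q rel) ∧
      Module.Finite ↥(Algebra.adjoin k {arrSum k Q rel}) (GA k Q rel)) := by
  refine ⟨⟨fun h ⟨l, hl⟩ => hgentle.not_finiteMaxWord_of_satCM2 hloc h l hl, fun h => ?_⟩,
    fun h => ?_⟩
  · obtain ⟨f, hf⟩ := exists_perm_follows hgentle h
    exact satCM2_of_perm hgentle hf
  · obtain ⟨f, hf⟩ := exists_perm_follows hgentle h
    exact free_and_finite_of_perm hf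

end LocGentle
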